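/- arXiv:2205.15074 — 4 statements merged into one kernel-verified Lean document; each statement's English description precedes it below -/
import Mathlib

section
/- Let λ_min < λ_max, P_max > 0, Γ ≥ 1, and Δ = (λ_max − λ_min)/2^Γ. Then for every λ ∈ [λ_min, λ_max] and every P ∈ [0, P_max], there exist z_1, …, z_Γ ∈ {0,1} and w_1, …, w_Γ ∈ ℝ satisfying, for every τ, 0 ≤ P − w_τ ≤ P_max·(1 − z_τ) and 0 ≤ w_τ ≤ P_max·z_τ, such that the linearized expression satisfies |λ·P − (λ_min·P + Δ · Σ_{τ=1}^{Γ} 2^{τ−1} w_τ)| ≤ Δ·P_max. Hence the binary-expansion MILP reformulation approximates the bilinear revenue term λ·P with error at most Δ·P_max, which tends to 0 as the number of segments Γ tends to infinity. -/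
/-- Every real number in `[0, 2 ^ n]` is within distance `1` of an `n`-bit binary expansion. -/
theorem exists_binary_expansion_abs_sub_le_one (n : ℕ) (x : ℝ) (hx0 : 0 ≤ x) (hx : x ≤ 2 ^ n) :
    ∃ z : Fin n → ℝ, (∀ i, z i = 0 ∨ z i = 1) ∧ |x - ∑ i : Fin n, 2 ^ (i : ℕ) * z i| ≤ 1 := by
  induction n generalizing x with
  | zero => exact ⟨0, by simp, by simpa [abs_of_nonneg hx0] using hx⟩
  | succ n ih =>
    have extend (b : ℝ) (hb : b = 0 ∨ b = 1) (h0 : 0 ≤ x - 2 ^ n * b)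
        (h1 : x - 2 ^ n * b ≤ 2 ^ n) :
        ∃ z : Fin (n + 1) → ℝ, (∀ i, z i = 0 ∨ z i = 1) ∧
          |x - ∑ i : Fin (n + 1), 2 ^ (i : ℕ) * z i| ≤ 1 := by
      obtain ⟨z, hz, h⟩ := ih _ h0 h1
      refine ⟨Fin.snoc z b, Fin.lastCases (by simpa using hb) (by simpa using hz), ?_⟩
      simpa [Fin.sum_univ_castSucc, sub_add_eq_sub_sub_swap] using h
    rw [pow_succ] at hx
    rcases le_total x (2 ^ n) with h | h
    · exact extend 0 (Or.inl rfl) (by linarith) (by linarith)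
    · exact extend 1 (Or.inr rfl) (by linarith) (by linarith)


/-- The binary-expansion MILP reformulation approximates the bilinear revenue
term `λ · P` with error at most `Δ · P_max`. -/
theorem binary_expansion_milp_approx
    (lmin lmax Pmax : ℝ) (hlt : lmin < lmax) (hPmax : 0 < Pmax)
    (Γ : ℕ) (hΓ : 1 ≤ Γ) :
    ∀ l P : ℝ, lmin ≤ l → l ≤ lmax → 0 ≤ P → P ≤ Pmax →
      ∃ (z w : Fin Γ → ℝ),
        (∀ τ, z τ = 0 ∨ z τ = 1) ∧
        (∀ τ, 0 ≤ P - w τ ∧ P - w τ ≤ Pmax * (1 - z τ) ∧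
              0 ≤ w τ ∧ w τ ≤ Pmax * z τ) ∧
        |l * P - (lmin * P +
            (lmax - lmin) / 2 ^ Γ * ∑ τ : Fin Γ, 2 ^ (τ : ℕ) * w τ)|
          ≤ (lmax - lmin) / 2 ^ Γ * Pmax := by
  intro l P hl hl' hP hP'
  have hd : 0 < (lmax - lmin) / 2 ^ Γ := div_pos (sub_pos.2 hlt) (by positivity)
  have hmul : (lmax - lmin) / 2 ^ Γ * 2 ^ Γ = lmax - lmin := by field_simp
  set d := (lmax - lmin) / 2 ^ Γ
  obtain ⟨z, hz, h⟩ := exists_binary_expansion_abs_sub_le_one Γ ((l - lmin) / d)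
    (div_nonneg (by linarith) hd.le) (by rw [div_le_iff₀ hd]; linarith)
  refine ⟨z, fun τ => z τ * P, hz, fun τ => ?_, ?_⟩
  · rcases hz τ with h | h <;> simp [h, hP, hP']
  · have hsum : ∑ τ : Fin Γ, 2 ^ (τ : ℕ) * (z τ * P) = (∑ τ : Fin Γ, 2 ^ (τ : ℕ) * z τ) * P := by
      simp only [Finset.sum_mul, mul_assoc]
    have herr : l * P - (lmin * P + d * ((∑ τ : Fin Γ, 2 ^ (τ : ℕ) * z τ) * P)) =
        d * (((l - lmin) / d - ∑ τ : Fin Γ, 2 ^ (τ : ℕ) * z τ) * P) := by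
      field_simp
      ring
    rw [hsum, herr, abs_mul, abs_mul, abs_of_pos hd, abs_of_nonneg hP]
    exact mul_le_mul_of_nonneg_left ((mul_le_of_le_one_left hP h).trans hP') hd.le
end

section
/- Consider the two-block problem minimize f(x) + g(z) subject to A x + B z = c, where f : ℝⁿ → ℝ and g : ℝᵐ → ℝ are convex and continuous, A is a real p×n matrix, B a real p×m matrix, and c ∈ ℝ^p. Fix a penalty parameter ρ > 0 and define the augmented Lagrangian L_ρ(x, z, y) = f(x) + g(z) + yᵀ(Ax + Bz − c) + (ρ/2)‖Ax + Bz − c‖². Suppose the unaugmented Lagrangian L₀(x, z, y) = f(x) + g(z) + yᵀ(Ax + Bz − c) has a saddle point (x*, z*, y*), i.e., L₀(x*, z*, y) ≤ L₀(x*, z*, y*) ≤ L₀(x, z, y*) for all x, z, y. Suppose sequences (x^k), (z^k), (y^k) satisfy the ADMM iterations: x^{k+1} is a global minimizer of x ↦ L_ρ(x, z^k, y^k), z^{k+1} is a global minimizer of z ↦ L_ρ(x^{k+1}, z, y^k), and y^{k+1} = y^k + ρ(A x^{k+1} + B z^{k+1} − c). Then the primal residual r^k = A x^k + B z^k − c converges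 to 0 as k → ∞. -/
open Matrix Filter

/-- First-order optimality, in variational form, for a convex function plus an augmented
Lagrangian penalty. -/
theorem le_of_isMin_augmented {n p : ℕ} {h : (Fin n → ℝ) → ℝ} (hh : ConvexOn ℝ Set.univ h)
    (T : Matrix (Fin p) (Fin n) ℝ) (b y : Fin p → ℝ) (ρ : ℝ) (u₀ : Fin n → ℝ)
    (hmin : ∀ u, h u₀ + y ⬝ᵥ (T.mulVec u₀ + b) +
        (ρ / 2) * ((T.mulVec u₀ + b) ⬝ᵥ (T.mulVec u₀ + b)) ≤
      h u + y ⬝ᵥ (T.mulVec u + b) + (ρ / 2) * ((T.mulVec u + b) ⬝ᵥ (T.mulVec u + b)))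
    (u : Fin n → ℝ) :
    h u₀ ≤ h u + (y + ρ • (T.mulVec u₀ + b)) ⬝ᵥ (T.mulVec u - T.mulVec u₀) := by
  set s := T.mulVec u₀ + b with hs
  set d := T.mulVec u - T.mulVec u₀ with hd
  have key : ∀ t ∈ Set.Ioo (0 : ℝ) 1,
      0 ≤ h u - h u₀ + (y + ρ • s) ⬝ᵥ d + t * ((ρ / 2) * (d ⬝ᵥ d)) := by
    rintro t ⟨ht0, ht1⟩
    have hconv := hh.2 (Set.mem_univ u₀) (Set.mem_univ u) (sub_nonneg.2 ht1.le) ht0.le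
      (sub_add_cancel 1 t)
    have hT : T.mulVec ((1 - t) • u₀ + t • u) + b = s + t • d := by
      rw [mulVec_add, mulVec_smul, mulVec_smul, hs, hd]
      module
    have hle := hmin ((1 - t) • u₀ + t • u)
    rw [hT] at hle
    simp only [dotProduct_add, add_dotProduct, smul_dotProduct, dotProduct_smul,
      smul_eq_mul, dotProduct_comm d s] at hle hconv ⊢
    refine nonneg_of_mul_nonneg_right ?_ ht0
    linarith
  have hlim : Tendsto (fun t : ℝ => h u - h u₀ + (y + ρ • s) ⬝ᵥ d + t * ((ρ / 2) * (d ⬝ᵥ d)))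
      (nhdsWithin 0 (Set.Ioi 0)) (nhds (h u - h u₀ + (y + ρ • s) ⬝ᵥ d)) := by
    have hcont : Continuous
        (fun t : ℝ => h u - h u₀ + (y + ρ • s) ⬝ᵥ d + t * ((ρ / 2) * (d ⬝ᵥ d))) := by fun_prop
    simpa using (hcont.tendsto 0).mono_left nhdsWithin_le_nhds
  have hnonneg := ge_of_tendsto hlim
    (eventually_of_mem (Ioo_mem_nhdsGT zero_lt_one) key)
  linarith

/-- One-step decrease of the ADMM Lyapunov function `‖w‖² / ρ + ρ ‖b‖²`, multiplied by `ρ`. -/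
theorem lyapunov_decrease {p : ℕ} {ρ : ℝ} (hρ : 0 < ρ) {w w' b b' r : Fin p → ℝ}
    (hw : w' = w + ρ • r) (hopt : w' ⬝ᵥ r ≤ ρ * ((b' - b) ⬝ᵥ (r - b')))
    (hmono : r ⬝ᵥ (b' - b) ≤ 0) :
    ρ ^ 2 * (r ⬝ᵥ r) ≤
      (w ⬝ᵥ w + ρ ^ 2 * (b ⬝ᵥ b)) - (w' ⬝ᵥ w' + ρ ^ 2 * (b' ⬝ᵥ b')) := by
  have hsq : 0 ≤ (b' - b) ⬝ᵥ (b' - b) := by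
    simpa using dotProduct_star_self_nonneg (b' - b)
  have h₁ := mul_le_mul_of_nonneg_left hopt hρ.le
  have h₂ := mul_nonneg (sq_nonneg ρ) hsq
  have h₃ := mul_nonpos_of_nonneg_of_nonpos (sq_nonneg ρ) hmono
  subst hw
  simp only [dotProduct_add, add_dotProduct, smul_dotProduct, dotProduct_smul, dotProduct_sub,
    sub_dotProduct, smul_eq_mul, dotProduct_comm b b', dotProduct_comm r b, dotProduct_comm r b',
    dotProduct_comm r w] at h₁ h₂ h₃ ⊢
  linarith

/-- A sequence dominated by the decrements of a nonnegative sequence tends to zero. -/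
theorem tendsto_zero_of_le_sub {a V : ℕ → ℝ} (ha : ∀ k, 0 ≤ a k) (hV : ∀ k, 0 ≤ V k)
    (h : ∀ k, a k ≤ V k - V (k + 1)) : Tendsto a atTop (nhds 0) := by
  have hanti : Antitone V := antitone_nat_of_succ_le fun k => by linarith [ha k, h k]
  have hlim := tendsto_atTop_ciInf hanti ⟨0, by rintro _ ⟨k, rfl⟩; exact hV k⟩
  refine squeeze_zero ha h ?_
  simpa using hlim.sub (hlim.comp (tendsto_add_atTop_nat 1))

/-- Vectors whose self dot products tend to zero tend to zero. -/
theorem tendsto_zero_of_dotProduct_self {p : ℕ} {r : ℕ → Fin p → ℝ}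
    (h : Tendsto (fun k => r k ⬝ᵥ r k) atTop (nhds 0)) : Tendsto r atTop (nhds 0) := by
  refine tendsto_pi_nhds.2 fun i => ?_
  have hsq : Tendsto (fun k => r k i ^ 2) atTop (nhds 0) := by
    refine squeeze_zero (fun k => sq_nonneg _) (fun k => ?_) h
    rw [sq]
    exact Finset.single_le_sum (f := fun j => r k j * r k j)
      (fun j _ => mul_self_nonneg _) (Finset.mem_univ i)
  refine (tendsto_zero_iff_abs_tendsto_zero _).2 ?_
  simpa [Function.comp_def, Real.sqrt_sq_eq_abs] using hsq.sqrt

/-- ADMM residual convergence: under the saddle-point assumption on the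
unaugmented Lagrangian, the primal residual `r^k = A x^k + B z^k - c`
converges to `0`. -/
theorem admm_residual_convergence
    {n m p : ℕ}
    (f : (Fin n → ℝ) → ℝ) (g : (Fin m → ℝ) → ℝ)
    (hf : ConvexOn ℝ Set.univ f) (hfc : Continuous f)
    (hg : ConvexOn ℝ Set.univ g) (hgc : Continuous g)
    (A : Matrix (Fin p) (Fin n) ℝ) (B : Matrix (Fin p) (Fin m) ℝ)
    (c : Fin p → ℝ) (ρ : ℝ) (hρ : 0 < ρ)
    (L0 : (Fin n → ℝ) → (Fin m → ℝ) → (Fin p → ℝ) → ℝ)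
    (hL0 : ∀ x z y, L0 x z y =
      f x + g z + y ⬝ᵥ (A.mulVec x + B.mulVec z - c))
    (Lρ : (Fin n → ℝ) → (Fin m → ℝ) → (Fin p → ℝ) → ℝ)
    (hLρ : ∀ x z y, Lρ x z y =
      f x + g z + y ⬝ᵥ (A.mulVec x + B.mulVec z - c) +
        (ρ / 2) * ((A.mulVec x + B.mulVec z - c) ⬝ᵥ (A.mulVec x + B.mulVec z - c)))
    -- saddle point of the unaugmented Lagrangian
    (xs : Fin n → ℝ) (zs : Fin m → ℝ) (ys : Fin p → ℝ)
    (hsaddle : ∀ x z y, L0 xs zs y ≤ L0 xs zs ys ∧ L0 xs zs ys ≤ L0 x z ys)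
    -- ADMM iterations
    (X : ℕ → Fin n → ℝ) (Z : ℕ → Fin m → ℝ) (Y : ℕ → Fin p → ℝ)
    (hX : ∀ k, ∀ u : Fin n → ℝ, Lρ (X (k + 1)) (Z k) (Y k) ≤ Lρ u (Z k) (Y k))
    (hZ : ∀ k, ∀ v : Fin m → ℝ,
      Lρ (X (k + 1)) (Z (k + 1)) (Y k) ≤ Lρ (X (k + 1)) v (Y k))
    (hY : ∀ k, Y (k + 1) =
      Y k + ρ • (A.mulVec (X (k + 1)) + B.mulVec (Z (k + 1)) - c)) :
    Tendsto (fun k => A.mulVec (X k) + B.mulVec (Z k) - c) atTop (nhds 0) := by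
  have hself : ∀ v : Fin p → ℝ, 0 ≤ v ⬝ᵥ v := fun v => by
    simpa using dotProduct_star_self_nonneg v
  have hfeas : A.mulVec xs + B.mulVec zs - c = 0 := by
    have h := (hsaddle xs zs (ys + (A.mulVec xs + B.mulVec zs - c))).1
    rw [hL0, hL0, add_dotProduct] at h
    exact dotProduct_self_eq_zero.1 (le_antisymm (by linarith) (hself _))
  have hc : c = A.mulVec xs + B.mulVec zs := (sub_eq_zero.1 hfeas).symm
  set r : ℕ → Fin p → ℝ := fun k => A.mulVec (X k) + B.mulVec (Z k) - c with hr
  set b : ℕ → Fin p → ℝ := fun k => B.mulVec (Z k) - B.mulVec zs with hb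
  have hYr : ∀ k, Y (k + 1) = Y k + ρ • r (k + 1) := hY
  have hoptX : ∀ k u, f (X (k + 1)) ≤ f u +
      (Y (k + 1) - ρ • (b (k + 1) - b k)) ⬝ᵥ (A.mulVec u - A.mulVec (X (k + 1))) := by
    intro k u
    have h := le_of_isMin_augmented hf A (B.mulVec (Z k) - c) (Y k) ρ (X (k + 1))
      (fun v => by
        have h := hX k v
        rw [hLρ, hLρ] at h
        simp only [← add_sub_assoc]
        linarith) u
    convert h using 3
    rw [hYr]
    simp only [hr, hb]
    module
  have hoptZ : ∀ k v, g (Z (k + 1)) ≤ g v +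
      Y (k + 1) ⬝ᵥ (B.mulVec v - B.mulVec (Z (k + 1))) := by
    intro k v
    have hcomm : ∀ v, B.mulVec v + (A.mulVec (X (k + 1)) - c) =
        A.mulVec (X (k + 1)) + B.mulVec v - c := fun v => by abel
    have h := le_of_isMin_augmented hg B (A.mulVec (X (k + 1)) - c) (Y k) ρ (Z (k + 1))
      (fun v => by
        have h := hZ k v
        rw [hLρ, hLρ] at h
        rw [hcomm, hcomm]
        linarith) v
    rwa [hcomm, ← hY] at h
  have hopt : ∀ k, (Y (k + 1) - ys) ⬝ᵥ r (k + 1) ≤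
      ρ * ((b (k + 1) - b k) ⬝ᵥ (r (k + 1) - b (k + 1))) := by
    intro k
    have hx := hoptX k xs
    have hz := hoptZ k zs
    have hs := (hsaddle (X (k + 1)) (Z (k + 1)) ys).2
    rw [hL0, hL0, hfeas, dotProduct_zero] at hs
    change _ ≤ _ + ys ⬝ᵥ r (k + 1) at hs
    have ha : A.mulVec xs - A.mulVec (X (k + 1)) = -(r (k + 1) - b (k + 1)) := by
      simp only [hr, hb, hc]
      abel
    have hb' : B.mulVec zs - B.mulVec (Z (k + 1)) = -b (k + 1) := by
      simp only [hb]
      abel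
    rw [ha, dotProduct_neg, sub_dotProduct, smul_dotProduct, smul_eq_mul,
      dotProduct_sub (Y (k + 1))] at hx
    rw [hb', dotProduct_neg] at hz
    rw [sub_dotProduct]
    linarith
  have hmono : ∀ k, r (k + 2) ⬝ᵥ (b (k + 2) - b (k + 1)) ≤ 0 := by
    intro k
    have h₁ := hoptZ (k + 1) (Z (k + 1))
    have h₂ := hoptZ k (Z (k + 2))
    have hb' : b (k + 2) - b (k + 1) = B.mulVec (Z (k + 2)) - B.mulVec (Z (k + 1)) := by
      simp only [hb]
      abel
    rw [← neg_sub, dotProduct_neg, hYr (k + 1), add_dotProduct, smul_dotProduct, smul_eq_mul] at h₁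
    rw [hb']
    refine nonpos_of_mul_nonpos_right ?_ hρ
    linarith
  have hlim : Tendsto (fun k => ρ ^ 2 * (r (k + 2) ⬝ᵥ r (k + 2))) atTop (nhds 0) :=
    tendsto_zero_of_le_sub
      (V := fun k => (Y (k + 1) - ys) ⬝ᵥ (Y (k + 1) - ys) + ρ ^ 2 * (b (k + 1) ⬝ᵥ b (k + 1)))
      (fun k => mul_nonneg (sq_nonneg ρ) (hself _))
      (fun k => add_nonneg (hself _) (mul_nonneg (sq_nonneg ρ) (hself _)))
      (fun k => lyapunov_decrease hρ (by rw [hYr (k + 1)]; abel) (hopt (k + 1)) (hmono k))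
  refine (tendsto_add_atTop_iff_nat 2).1 (tendsto_zero_of_dotProduct_self ?_)
  have h := hlim.const_mul (ρ ^ 2)⁻¹
  rw [mul_zero] at h
  exact h.congr fun k => inv_mul_cancel_left₀ (pow_ne_zero 2 hρ.ne') _
end

section
/- Consider the two-block problem minimize f(x) + g(z) subject to A x + B z = c, where f : ℝⁿ → ℝ and g : ℝᵐ → ℝ are convex and continuous, A is a real p×n matrix, B a real p×m matrix, and c ∈ ℝ^p, and let p* denote the optimal value of this problem. Fix ρ > 0 and suppose the unaugmented Lagrangian L₀(x, z, y) = f(x) + g(z) + yᵀ(Ax + Bz − c) has a saddle point (x*, z*, y*). Suppose sequences (x^k), (z^k), (y^k) satisfy the ADMM iterations: x^{k+1} is a global minimizer of x ↦ L_ρ(x, z^k, y^k), z^{k+1} is a global minimizer of z ↦ L_ρ(x^{k+1}, z, y^k), and y^{k+1} = y^k + ρ(A x^{k+1} + B z^{k+1} − c). Then the objective values converge to the optimum: f(x^k) + g(z^k) → p* as k → ∞. -/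
open Matrix Filter

/-- A minimizer of a convex function plus a quadratic penalty of `A u + d` also minimizes the
function plus the linearization of the penalty. -/
theorem ConvexOn.le_add_dotProduct_of_forall_penalty_le {n p : ℕ} {f : (Fin n → ℝ) → ℝ}
    (hf : ConvexOn ℝ Set.univ f) (A : Matrix (Fin p) (Fin n) ℝ) (d y : Fin p → ℝ) (ρ : ℝ)
    (x : Fin n → ℝ)
    (hx : ∀ u, f x + y ⬝ᵥ (A *ᵥ x + d) + (ρ / 2) * ((A *ᵥ x + d) ⬝ᵥ (A *ᵥ x + d)) ≤
      f u + y ⬝ᵥ (A *ᵥ u + d) + (ρ / 2) * ((A *ᵥ u + d) ⬝ᵥ (A *ᵥ u + d)))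
    (u : Fin n → ℝ) :
    f x ≤ f u + (y + ρ • (A *ᵥ x + d)) ⬝ᵥ (A *ᵥ u - A *ᵥ x) := by
  set s := A *ᵥ x + d with hs
  set h := A *ᵥ u - A *ᵥ x with hh
  have key : ∀ t : ℝ, 0 < t → t ≤ 1 →
      0 ≤ (f u + (y + ρ • s) ⬝ᵥ h - f x) + t * ((ρ / 2) * (h ⬝ᵥ h)) := by
    intro t ht ht1
    have hconv := hf.2 (Set.mem_univ x) (Set.mem_univ u) (sub_nonneg.2 ht1) ht.le (by ring)
    have hmin := hx ((1 - t) • x + t • u)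
    have hA : A *ᵥ ((1 - t) • x + t • u) + d = s + t • h := by
      rw [mulVec_add, mulVec_smul, mulVec_smul, hs, hh]
      module
    rw [hA] at hmin
    simp only [smul_eq_mul] at hconv
    simp only [dotProduct_add, add_dotProduct, dotProduct_smul, smul_dotProduct,
      smul_eq_mul, dotProduct_comm h s] at hmin ⊢
    refine nonneg_of_mul_nonneg_left (b := t) ?_ ht
    linarith
  have hlim : Tendsto (fun t : ℝ => (f u + (y + ρ • s) ⬝ᵥ h - f x) + t * ((ρ / 2) * (h ⬝ᵥ h)))
      (nhdsWithin 0 (Set.Ioi 0)) (nhds (f u + (y + ρ • s) ⬝ᵥ h - f x)) := by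
    refine Tendsto.mono_left ?_ nhdsWithin_le_nhds
    refine Continuous.tendsto' (by fun_prop) _ _ (by simp)
  have hnonneg := ge_of_tendsto hlim (by
    filter_upwards [Ioc_mem_nhdsGT (zero_lt_one (α := ℝ))] with t ht using key t ht.1 ht.2)
  linarith

theorem dotProduct_self_nonneg {p : ℕ} (v : Fin p → ℝ) : 0 ≤ v ⬝ᵥ v :=
  Finset.sum_nonneg fun i _ => mul_self_nonneg (v i)

theorem tendsto_dotProduct_zero_of_bounded {p : ℕ} {u v : ℕ → Fin p → ℝ} {C : ℝ}
    (hu : ∀ k, u k ⬝ᵥ u k ≤ C) (hv : Tendsto (fun k => v k ⬝ᵥ v k) atTop (nhds 0)) :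
    Tendsto (fun k => u k ⬝ᵥ v k) atTop (nhds 0) := by
  have hsq : Tendsto (fun k => (u k ⬝ᵥ v k) ^ 2) atTop (nhds 0) := by
    refine squeeze_zero (fun k => sq_nonneg _) (fun k => ?_) (by simpa using hv.const_mul C)
    calc (u k ⬝ᵥ v k) ^ 2 ≤ (u k ⬝ᵥ u k) * (v k ⬝ᵥ v k) := by
          simpa only [dotProduct, sq] using
            Finset.sum_mul_sq_le_sq_mul_sq Finset.univ (u k) (v k)
      _ ≤ C * (v k ⬝ᵥ v k) :=
          mul_le_mul_of_nonneg_right (hu k) (dotProduct_self_nonneg (v k))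
  rw [tendsto_zero_iff_abs_tendsto_zero]
  simpa [Function.comp_def, Real.sqrt_sq_eq_abs] using hsq.sqrt

theorem tendsto_zero_of_add_le {V d : ℕ → ℝ} (hV : ∀ k, 0 ≤ V k) (hd : ∀ k, 0 ≤ d k)
    (h : ∀ k, V (k + 1) + d k ≤ V k) : Tendsto d atTop (nhds 0) := by
  have hanti : Antitone V := antitone_nat_of_succ_le fun k => by linarith [h k, hd k]
  have hlim := tendsto_atTop_ciInf hanti ⟨0, by rintro _ ⟨k, rfl⟩; exact hV k⟩
  have hdiff := hlim.sub (hlim.comp (tendsto_add_atTop_nat 1))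
  rw [sub_self] at hdiff
  exact squeeze_zero hd (fun k => by simpa using by linarith [h k]) hdiff

/-- ADMM objective convergence: under the saddle-point assumption on the
unaugmented Lagrangian, the objective values `f(x^k) + g(z^k)` converge to
the optimal value `p*` of the problem. -/
theorem admm_objective_convergence
    {n m p : ℕ}
    (f : (Fin n → ℝ) → ℝ) (g : (Fin m → ℝ) → ℝ)
    (hf : ConvexOn ℝ Set.univ f) (hfc : Continuous f)
    (hg : ConvexOn ℝ Set.univ g) (hgc : Continuous g)
    (A : Matrix (Fin p) (Fin n) ℝ) (B : Matrix (Fin p) (Fin m) ℝ)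
    (c : Fin p → ℝ) (ρ : ℝ) (hρ : 0 < ρ)
    (pstar : ℝ)
    (hpstar : pstar = sInf {v : ℝ | ∃ (x : Fin n → ℝ) (z : Fin m → ℝ),
      A.mulVec x + B.mulVec z = c ∧ v = f x + g z})
    (L0 : (Fin n → ℝ) → (Fin m → ℝ) → (Fin p → ℝ) → ℝ)
    (hL0 : ∀ x z y, L0 x z y =
      f x + g z + y ⬝ᵥ (A.mulVec x + B.mulVec z - c))
    (Lρ : (Fin n → ℝ) → (Fin m → ℝ) → (Fin p → ℝ) → ℝ)
    (hLρ : ∀ x z y, Lρ x z y =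
      f x + g z + y ⬝ᵥ (A.mulVec x + B.mulVec z - c) +
        (ρ / 2) * ((A.mulVec x + B.mulVec z - c) ⬝ᵥ (A.mulVec x + B.mulVec z - c)))
    -- saddle point of the unaugmented Lagrangian
    (xs : Fin n → ℝ) (zs : Fin m → ℝ) (ys : Fin p → ℝ)
    (hsaddle : ∀ x z y, L0 xs zs y ≤ L0 xs zs ys ∧ L0 xs zs ys ≤ L0 x z ys)
    -- ADMM iterations
    (X : ℕ → Fin n → ℝ) (Z : ℕ → Fin m → ℝ) (Y : ℕ → Fin p → ℝ)
    (hX : ∀ k, ∀ u : Fin n → ℝ, Lρ (X (k + 1)) (Z k) (Y k) ≤ Lρ u (Z k) (Y k))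
    (hZ : ∀ k, ∀ v : Fin m → ℝ,
      Lρ (X (k + 1)) (Z (k + 1)) (Y k) ≤ Lρ (X (k + 1)) v (Y k))
    (hY : ∀ k, Y (k + 1) =
      Y k + ρ • (A.mulVec (X (k + 1)) + B.mulVec (Z (k + 1)) - c)) :
    Tendsto (fun k => f (X k) + g (Z k)) atTop (nhds pstar) := by
  have hfeas : A *ᵥ xs + B *ᵥ zs - c = 0 := by
    have h := (hsaddle xs zs (ys + (A *ᵥ xs + B *ᵥ zs - c))).1
    rw [hL0, hL0, add_dotProduct] at h
    exact dotProduct_self_eq_zero.1 (le_antisymm (by linarith) (dotProduct_self_nonneg _))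
  have hopt : ∀ x z, f xs + g zs ≤ f x + g z + ys ⬝ᵥ (A *ᵥ x + B *ᵥ z - c) := by
    intro x z
    have h := (hsaddle x z ys).2
    rwa [hL0, hL0, hfeas, dotProduct_zero, add_zero] at h
  have hp : pstar = f xs + g zs := by
    rw [hpstar]
    refine IsLeast.csInf_eq ⟨⟨xs, zs, sub_eq_zero.1 hfeas, rfl⟩, ?_⟩
    rintro _ ⟨x, z, hxz, rfl⟩
    simpa [hxz] using hopt x z
  have hfX : ∀ k u, f (X (k + 1)) ≤ f u +
      (Y k + ρ • (A *ᵥ X (k + 1) + (B *ᵥ Z k - c))) ⬝ᵥ (A *ᵥ u - A *ᵥ X (k + 1)) := by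
    intro k
    refine hf.le_add_dotProduct_of_forall_penalty_le A (B *ᵥ Z k - c) (Y k) ρ _ fun u => ?_
    have h := hX k u
    rw [hLρ, hLρ] at h
    simp only [← add_sub_assoc]
    linarith
  have hgZ : ∀ k v, g (Z (k + 1)) ≤ g v + Y (k + 1) ⬝ᵥ (B *ᵥ v - B *ᵥ Z (k + 1)) := by
    intro k v
    have hcomm : ∀ w, B *ᵥ w + (A *ᵥ X (k + 1) - c) = A *ᵥ X (k + 1) + B *ᵥ w - c :=
      fun w => by abel
    have h := hg.le_add_dotProduct_of_forall_penalty_le B (A *ᵥ X (k + 1) - c) (Y k) ρ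
      (Z (k + 1)) (fun v => by
        have h := hZ k v
        rw [hLρ, hLρ] at h
        rw [hcomm, hcomm]
        linarith) v
    rwa [hcomm, ← hY] at h
  let r : ℕ → Fin p → ℝ := fun k => A *ᵥ X (k + 2) + B *ᵥ Z (k + 2) - c
  let b : ℕ → Fin p → ℝ := fun k => B *ᵥ Z (k + 2) - B *ᵥ Z (k + 1)
  let e : ℕ → Fin p → ℝ := fun k => B *ᵥ Z (k + 1) - B *ᵥ zs
  let a : ℕ → Fin p → ℝ := fun k => Y (k + 1) - ys
  have ha : ∀ k, a (k + 1) = a k + ρ • r k := fun k => by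
    simp only [a, r, hY (k + 1)]
    abel
  have he : ∀ k, e (k + 1) = e k + b k := fun k => by
    simp only [e, b]
    abel
  have hlow : ∀ k, f xs + g zs - ys ⬝ᵥ r k ≤ f (X (k + 2)) + g (Z (k + 2)) := fun k => by
    linarith [hopt (X (k + 2)) (Z (k + 2))]
  have hupp : ∀ k, f (X (k + 2)) + g (Z (k + 2)) ≤ f xs + g zs - ys ⬝ᵥ r k
      - a (k + 1) ⬝ᵥ r k - ρ * (e (k + 1) ⬝ᵥ b k) + ρ * (r k ⬝ᵥ b k) := by
    intro k
    have h1 := hfX (k + 1) xs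
    have h2 := hgZ (k + 1) zs
    have hw : Y (k + 1) + ρ • (A *ᵥ X (k + 2) + (B *ᵥ Z (k + 1) - c))
        = (a (k + 1) + ys) - ρ • b k := by
      simp only [a, b, hY (k + 1)]
      module
    have hAx : A *ᵥ xs - A *ᵥ X (k + 2) = e (k + 1) - r k := by
      rw [eq_sub_of_add_eq (sub_eq_zero.1 hfeas)]
      simp only [e, r]
      abel
    have hBz : B *ᵥ zs - B *ᵥ Z (k + 2) = - e (k + 1) := by simp [e]
    have hYa : Y (k + 2) = a (k + 1) + ys := by simp [a]
    rw [show k + 1 + 1 = k + 2 from rfl] at h1 h2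
    rw [hw, hAx] at h1
    rw [hBz, hYa] at h2
    simp only [add_dotProduct, sub_dotProduct, dotProduct_sub, dotProduct_neg,
      smul_dotProduct, smul_eq_mul] at h1 h2
    rw [dotProduct_comm (e (k + 1)), dotProduct_comm (r k)]
    linarith
  have hmono : ∀ k, r k ⬝ᵥ b k ≤ 0 := by
    intro k
    have h1 := hgZ (k + 1) (Z (k + 1))
    have h2 := hgZ k (Z (k + 2))
    have hb : B *ᵥ Z (k + 1) - B *ᵥ Z (k + 2) = - b k := by simp [b]
    have hYr : Y (k + 2) = Y (k + 1) + ρ • r k := hY (k + 1)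
    rw [show k + 1 + 1 = k + 2 from rfl, hb, hYr, dotProduct_neg, add_dotProduct,
      smul_dotProduct, smul_eq_mul] at h1
    change _ ≤ _ + _ ⬝ᵥ b k at h2
    exact nonpos_of_mul_nonpos_right (by linarith) hρ
  -- The Lyapunov function, scaled by `ρ` to avoid dividing.
  let V : ℕ → ℝ := fun k => a k ⬝ᵥ a k + ρ ^ 2 * (e k ⬝ᵥ e k)
  have hV : ∀ k, 0 ≤ V k := fun k =>
    add_nonneg (dotProduct_self_nonneg _) (mul_nonneg (sq_nonneg ρ) (dotProduct_self_nonneg _))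
  have hd : ∀ k, 0 ≤ ρ ^ 2 * (r k ⬝ᵥ r k + b k ⬝ᵥ b k) := fun k =>
    mul_nonneg (sq_nonneg ρ) (add_nonneg (dotProduct_self_nonneg _) (dotProduct_self_nonneg _))
  have hdec : ∀ k, V (k + 1) + ρ ^ 2 * (r k ⬝ᵥ r k + b k ⬝ᵥ b k) ≤ V k := by
    intro k
    have h : a (k + 1) ⬝ᵥ r k + ρ * (e (k + 1) ⬝ᵥ b k) ≤ 0 := by
      linarith [hlow k, hupp k, mul_nonpos_of_nonneg_of_nonpos hρ.le (hmono k)]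
    have h' := mul_nonpos_of_nonneg_of_nonpos hρ.le h
    simp only [V]
    rw [ha, he] at h' ⊢
    simp only [add_dotProduct, dotProduct_add, smul_dotProduct, dotProduct_smul,
      smul_eq_mul, dotProduct_comm (r k) (a k), dotProduct_comm (b k) (e k)] at h' ⊢
    linarith
  have hd0 := tendsto_zero_of_add_le hV hd hdec
  have hVle : ∀ k, V k ≤ V 0 := fun k =>
    antitone_nat_of_succ_le (fun j => by linarith [hdec j, hd j]) (Nat.zero_le k)
  have hρ2 : 0 < ρ ^ 2 := by positivity
  have hsum : Tendsto (fun k => r k ⬝ᵥ r k + b k ⬝ᵥ b k) atTop (nhds 0) := by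
    have h := hd0.const_mul (ρ ^ 2)⁻¹
    rw [mul_zero] at h
    exact h.congr fun k => inv_mul_cancel_left₀ hρ2.ne' _
  have hr0 : Tendsto (fun k => r k ⬝ᵥ r k) atTop (nhds 0) :=
    squeeze_zero (fun k => dotProduct_self_nonneg _)
      (fun k => le_add_of_nonneg_right (dotProduct_self_nonneg _)) hsum
  have hb0 : Tendsto (fun k => b k ⬝ᵥ b k) atTop (nhds 0) :=
    squeeze_zero (fun k => dotProduct_self_nonneg _)
      (fun k => le_add_of_nonneg_left (dotProduct_self_nonneg _)) hsum
  have hys := tendsto_dotProduct_zero_of_bounded (u := fun _ => ys) (fun _ => le_rfl) hr0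
  have har : Tendsto (fun k => a (k + 1) ⬝ᵥ r k) atTop (nhds 0) :=
    tendsto_dotProduct_zero_of_bounded (fun k => (le_add_of_nonneg_right
      (mul_nonneg (sq_nonneg ρ) (dotProduct_self_nonneg _))).trans (hVle (k + 1))) hr0
  have heb : Tendsto (fun k => e (k + 1) ⬝ᵥ b k) atTop (nhds 0) :=
    tendsto_dotProduct_zero_of_bounded (fun k => (le_div_iff₀' hρ2).2
      ((le_add_of_nonneg_left (dotProduct_self_nonneg _)).trans (hVle (k + 1)))) hb0
  rw [← tendsto_add_atTop_iff_nat 2, hp]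
  refine tendsto_of_tendsto_of_tendsto_of_le_of_le (g := fun k => f xs + g zs - ys ⬝ᵥ r k)
    (h := fun k => f xs + g zs - ys ⬝ᵥ r k - a (k + 1) ⬝ᵥ r k - ρ * (e (k + 1) ⬝ᵥ b k))
    ?_ ?_ hlow fun k => ?_
  · simpa using hys.const_sub (f xs + g zs)
  · simpa using ((hys.const_sub (f xs + g zs)).sub har).sub (heb.const_mul ρ)
  · linarith [hupp k, mul_nonpos_of_nonneg_of_nonpos hρ.le (hmono k)]
end

section
/- Consider the two-block problem minimize f(x) + g(z) subject to A x + B z = c, where f : ℝⁿ → ℝ and g : ℝᵐ → ℝ are convex and continuous, A is a real p×n matrix, B a real p×m matrix, and c ∈ ℝ^p. Fix ρ > 0 and suppose the unaugmented Lagrangian L₀(x, z, y) = f(x) + g(z) + yᵀ(Ax + Bz − c) has a saddle point (x*, z*, y*). Suppose sequences (x^k), (z^k), (y^k) satisfy the ADMM iterations: x^{k+1} is a global minimizer of x ↦ L_ρ(x, z^k, y^k), z^{k+1} is a global minimizer of z ↦ L_ρ(x^{k+1}, z, y^k), and y^{k+1} = y^k + ρ(A x^{k+1} + B z^{k+1}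 − c). Then the dual variable sequence (y^k) converges to a dual optimal point, i.e., y^k → y° for some y° such that (x*, z*, y°) can be taken as the dual component of a saddle point of L₀; in particular the sequence (y^k) converges. -/
open Matrix Filter Topology

theorem sq_apply_le_dotProduct_self {ι : Type*} [Fintype ι] (v : ι → ℝ) (i : ι) :
    v i ^ 2 ≤ v ⬝ᵥ v := by
  rw [sq]
  exact Finset.single_le_sum (f := fun j => v j * v j) (fun j _ => mul_self_nonneg (v j))
    (Finset.mem_univ i)

theorem dotProduct_self_nonneg_real {ι : Type*} [Fintype ι] (v : ι → ℝ) : 0 ≤ v ⬝ᵥ v :=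
  Finset.sum_nonneg fun i _ => mul_self_nonneg (v i)

theorem norm_le_of_dotProduct_self_le {ι : Type*} [Fintype ι] {v : ι → ℝ} {C : ℝ}
    (h : v ⬝ᵥ v ≤ C) : ‖v‖ ≤ √C :=
  (pi_norm_le_iff_of_nonneg (Real.sqrt_nonneg C)).2 fun i =>
    Real.abs_le_sqrt ((sq_apply_le_dotProduct_self v i).trans h)

theorem tendsto_of_dotProduct_sub_self {ι α : Type*} [Fintype ι] {l : Filter α}
    {v : α → ι → ℝ} {a : ι → ℝ}
    (h : Tendsto (fun k => (v k - a) ⬝ᵥ (v k - a)) l (𝓝 0)) : Tendsto v l (𝓝 a) := by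
  rw [tendsto_iff_norm_sub_tendsto_zero]
  refine squeeze_zero (fun _ => norm_nonneg _) (fun k => norm_le_of_dotProduct_self_le le_rfl) ?_
  simpa using h.sqrt

theorem Filter.Tendsto.dotProduct {ι α : Type*} [Fintype ι] {l : Filter α}
    {u v : α → ι → ℝ} {a b : ι → ℝ} (hu : Tendsto u l (𝓝 a)) (hv : Tendsto v l (𝓝 b)) :
    Tendsto (fun k => u k ⬝ᵥ v k) l (𝓝 (a ⬝ᵥ b)) :=
  tendsto_finsetSum _ fun i _ => (tendsto_pi_nhds.1 hu i).mul (tendsto_pi_nhds.1 hv i)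

/-- First-order optimality condition for the sum of a convex function and a quadratic
function of a linear image. -/
theorem ConvexOn.add_dotProduct_le_of_isMin {ι κ : Type*} [Fintype ι] [Fintype κ]
    {f : (ι → ℝ) → ℝ} (hf : ConvexOn ℝ Set.univ f) (A : Matrix κ ι ℝ) (y d : κ → ℝ) (σ : ℝ)
    {x : ι → ℝ}
    (hx : ∀ u, f x + y ⬝ᵥ (A *ᵥ x + d) + σ / 2 * ((A *ᵥ x + d) ⬝ᵥ (A *ᵥ x + d)) ≤
      f u + y ⬝ᵥ (A *ᵥ u + d) + σ / 2 * ((A *ᵥ u + d) ⬝ᵥ (A *ᵥ u + d))) (u : ι → ℝ) :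
    f x + (y + σ • (A *ᵥ x + d)) ⬝ᵥ (A *ᵥ x) ≤ f u + (y + σ • (A *ᵥ x + d)) ⬝ᵥ (A *ᵥ u) := by
  set w := y + σ • (A *ᵥ x + d) with hw
  set e := A *ᵥ u - A *ᵥ x with he
  have hstep : ∀ t ∈ Set.Ioo (0 : ℝ) 1, 0 ≤ f u - f x + w ⬝ᵥ e + t * (σ / 2 * (e ⬝ᵥ e)) := by
    rintro t ⟨ht0, ht1⟩
    have hconv := hf.2 (Set.mem_univ x) (Set.mem_univ u) (sub_nonneg.2 ht1.le) ht0.le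
      (sub_add_cancel 1 t)
    have hmin := hx ((1 - t) • x + t • u)
    have himage : A *ᵥ ((1 - t) • x + t • u) + d = (A *ᵥ x + d) + t • e := by
      rw [he, mulVec_add, mulVec_smul, mulVec_smul]
      module
    rw [himage] at hmin
    have hexpand : y ⬝ᵥ ((A *ᵥ x + d) + t • e) +
          σ / 2 * (((A *ᵥ x + d) + t • e) ⬝ᵥ ((A *ᵥ x + d) + t • e)) =
        y ⬝ᵥ (A *ᵥ x + d) + σ / 2 * ((A *ᵥ x + d) ⬝ᵥ (A *ᵥ x + d)) +
          t * (w ⬝ᵥ e + t * (σ / 2 * (e ⬝ᵥ e))) := by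
      rw [hw]
      simp only [dotProduct, Finset.mul_sum, ← Finset.sum_add_distrib]
      refine Finset.sum_congr rfl fun i _ => ?_
      simp only [Pi.add_apply, Pi.smul_apply, smul_eq_mul]
      ring
    simp only [smul_eq_mul] at hconv
    refine (mul_nonneg_iff_of_pos_left ht0).1 ?_
    linarith
  have hlim : Tendsto (fun t : ℝ => f u - f x + w ⬝ᵥ e + t * (σ / 2 * (e ⬝ᵥ e))) (𝓝[>] 0)
      (𝓝 (f u - f x + w ⬝ᵥ e)) := by
    have hcont : Continuous fun t : ℝ => f u - f x + w ⬝ᵥ e + t * (σ / 2 * (e ⬝ᵥ e)) := by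
      fun_prop
    simpa using (hcont.tendsto 0).mono_left nhdsWithin_le_nhds
  have hnonneg := ge_of_tendsto hlim
    (mem_of_superset (Ioo_mem_nhdsGT one_pos) hstep)
  rw [he, dotProduct_sub] at hnonneg
  linarith

theorem dotProduct_sub_nonpos_of_le {κ : Type*} [Fintype κ] {v w a b : κ → ℝ} {α β : ℝ}
    (h₁ : α + v ⬝ᵥ a ≤ β + v ⬝ᵥ b) (h₂ : β + w ⬝ᵥ b ≤ α + w ⬝ᵥ a) :
    (v - w) ⬝ᵥ (a - b) ≤ 0 := by
  simp only [sub_dotProduct, dotProduct_sub]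
  linarith

section MonotoneInclusion

variable {ι : Type*} [Fintype ι] {ρ : ℝ} {c : ι → ℝ} {y s q : ℕ → ι → ℝ}

theorem admm_lyapunov_descent (hρ : 0 < ρ)
    (hy : ∀ k, y (k + 1) = y k + ρ • (q (k + 1) + s (k + 1) - c))
    (hs : ∀ j k, (y j - y k) ⬝ᵥ (s j - s k) ≤ 0) {a b yo : ι → ℝ} (hab : a + b = c)
    (hsb : ∀ k, (y k - yo) ⬝ᵥ (s k - b) ≤ 0)
    (hqa : ∀ k, (y (k + 1) - ρ • (s (k + 1) - s k) - yo) ⬝ᵥ (q (k + 1) - a) ≤ 0) (k : ℕ) :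
    (y (k + 1) - yo) ⬝ᵥ (y (k + 1) - yo) + ρ ^ 2 * ((s (k + 1) - b) ⬝ᵥ (s (k + 1) - b)) +
        ((y (k + 1) - y k) ⬝ᵥ (y (k + 1) - y k) +
          ρ ^ 2 * ((s (k + 1) - s k) ⬝ᵥ (s (k + 1) - s k))) ≤
      (y k - yo) ⬝ᵥ (y k - yo) + ρ ^ 2 * ((s k - b) ⬝ᵥ (s k - b)) := by
  have hid : (y k - yo) ⬝ᵥ (y k - yo) + ρ ^ 2 * ((s k - b) ⬝ᵥ (s k - b)) +
        (2 * ρ) * ((y (k + 1) - ρ • (s (k + 1) - s k) - yo) ⬝ᵥ (q (k + 1) - a)) +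
        (2 * ρ) * ((y (k + 1) - yo) ⬝ᵥ (s (k + 1) - b)) +
        (2 * ρ) * ((y (k + 1) - y k) ⬝ᵥ (s (k + 1) - s k)) =
      (y (k + 1) - yo) ⬝ᵥ (y (k + 1) - yo) + ρ ^ 2 * ((s (k + 1) - b) ⬝ᵥ (s (k + 1) - b)) +
        ((y (k + 1) - y k) ⬝ᵥ (y (k + 1) - y k) +
          ρ ^ 2 * ((s (k + 1) - s k) ⬝ᵥ (s (k + 1) - s k))) := by
    simp only [dotProduct, Finset.mul_sum, ← Finset.sum_add_distrib]
    refine Finset.sum_congr rfl fun i _ => ?_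
    simp only [hy k, ← hab, Pi.add_apply, Pi.sub_apply, Pi.smul_apply, smul_eq_mul]
    ring
  have h2ρ : 0 ≤ 2 * ρ := by positivity
  have h₁ := mul_nonpos_of_nonneg_of_nonpos h2ρ (hqa k)
  have h₂ := mul_nonpos_of_nonneg_of_nonpos h2ρ (hsb (k + 1))
  have h₃ := mul_nonpos_of_nonneg_of_nonpos h2ρ (hs (k + 1) k)
  linarith

/-- Convergence of the ADMM recursion, phrased for monotone inclusions: `s` and `q` play the
roles of `B z` and `A x`. -/
theorem admm_tendsto_of_monotone (hρ : 0 < ρ)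
    (hy : ∀ k, y (k + 1) = y k + ρ • (q (k + 1) + s (k + 1) - c))
    (hs : ∀ j k, (y j - y k) ⬝ᵥ (s j - s k) ≤ 0)
    (hq : ∀ j k, ((y (j + 1) - ρ • (s (j + 1) - s j)) -
      (y (k + 1) - ρ • (s (k + 1) - s k))) ⬝ᵥ (q (j + 1) - q (k + 1)) ≤ 0)
    {a b ys : ι → ℝ} (hab : a + b = c) (hsb : ∀ k, (y k - ys) ⬝ᵥ (s k - b) ≤ 0)
    (hqa : ∀ k, (y (k + 1) - ρ • (s (k + 1) - s k) - ys) ⬝ᵥ (q (k + 1) - a) ≤ 0) :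
    ∃ yo so, Tendsto y atTop (𝓝 yo) ∧ Tendsto s atTop (𝓝 so) ∧
      Tendsto (fun k => q (k + 1)) atTop (𝓝 (c - so)) := by
  have hρ2 : 0 < ρ ^ 2 := by positivity
  have hnn := dotProduct_self_nonneg_real (ι := ι)
  have hq_eq : ∀ k, q (k + 1) = ρ⁻¹ • (y (k + 1) - y k) + c - s (k + 1) := by
    intro k
    rw [hy k, add_sub_cancel_left, inv_smul_smul₀ hρ.ne']
    abel
  set V : ℕ → ℝ := fun k => (y k - ys) ⬝ᵥ (y k - ys) + ρ ^ 2 * ((s k - b) ⬝ᵥ (s k - b)) with hV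
  have hdesc : ∀ k, V (k + 1) + ((y (k + 1) - y k) ⬝ᵥ (y (k + 1) - y k) +
      ρ ^ 2 * ((s (k + 1) - s k) ⬝ᵥ (s (k + 1) - s k))) ≤ V k :=
    admm_lyapunov_descent hρ hy hs hab hsb hqa
  have hVanti : Antitone V := antitone_nat_of_succ_le fun k => by
    have h₁ := hnn (y (k + 1) - y k)
    have h₂ := mul_nonneg hρ2.le (hnn (s (k + 1) - s k))
    linarith [hdesc k]
  have hVnn : ∀ k, 0 ≤ V k := fun k => add_nonneg (hnn _) (mul_nonneg hρ2.le (hnn _))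
  have hgap : Tendsto (fun k => V k - V (k + 1)) atTop (𝓝 0) := by
    have hlim := tendsto_atTop_ciInf hVanti ⟨0, Set.forall_mem_range.2 hVnn⟩
    simpa using hlim.sub (hlim.comp (tendsto_add_atTop_nat 1))
  have hdy : Tendsto (fun k => y (k + 1) - y k) atTop (𝓝 0) := by
    refine tendsto_of_dotProduct_sub_self (squeeze_zero (fun k => hnn _) (fun k => ?_) hgap)
    have h₂ := mul_nonneg hρ2.le (hnn (s (k + 1) - s k))
    rw [sub_zero]
    linarith [hdesc k]
  have hds : Tendsto (fun k => s (k + 1) - s k) atTop (𝓝 0) := by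
    refine tendsto_of_dotProduct_sub_self (squeeze_zero (fun k => hnn _) (fun k => ?_)
      (by simpa using hgap.div_const (ρ ^ 2)))
    have h₁ := hnn (y (k + 1) - y k)
    rw [sub_zero, le_div_iff₀ hρ2]
    linarith [hdesc k]
  obtain ⟨⟨yo, so⟩, -, φ, hφ, hlim⟩ := tendsto_subseq_of_bounded
    (s := Metric.closedBall ys √(V 0) ×ˢ Metric.closedBall b √(V 0 / ρ ^ 2))
    (x := fun k => (y (k + 1), s (k + 1)))
    (Metric.isBounded_closedBall.prod Metric.isBounded_closedBall) (fun k => by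
      have hk : V (k + 1) ≤ V 0 := hVanti (Nat.zero_le _)
      refine Set.mk_mem_prod ?_ ?_ <;>
        rw [Metric.mem_closedBall, dist_eq_norm] <;> apply norm_le_of_dotProduct_self_le
      · have h₂ := mul_nonneg hρ2.le (hnn (s (k + 1) - b))
        simp only [hV] at hk ⊢
        linarith
      · have h₁ := hnn (y (k + 1) - ys)
        rw [le_div_iff₀ hρ2]
        simp only [hV] at hk ⊢
        linarith)
  have hyφ : Tendsto (fun k => y (φ k + 1)) atTop (𝓝 yo) := hlim.fst_nhds
  have hsφ : Tendsto (fun k => s (φ k + 1)) atTop (𝓝 so) := hlim.snd_nhds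
  have hqφ : Tendsto (fun k => q (φ k + 1)) atTop (𝓝 (c - so)) := by
    simp only [hq_eq]
    simpa using (((hdy.comp hφ.tendsto_atTop).const_smul ρ⁻¹).add_const c).sub hsφ
  have hwφ : Tendsto (fun k => y (φ k + 1) - ρ • (s (φ k + 1) - s (φ k))) atTop (𝓝 yo) := by
    simpa using hyφ.sub ((hds.comp hφ.tendsto_atTop).const_smul ρ)
  have hdesc' := admm_lyapunov_descent hρ hy hs (sub_add_cancel c so)
    (fun k => le_of_tendsto ((hyφ.const_sub (y k)).dotProduct (hsφ.const_sub (s k)))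
      (Eventually.of_forall fun j => hs k (φ j + 1)))
    (fun k => le_of_tendsto ((hwφ.const_sub _).dotProduct (hqφ.const_sub (q (k + 1))))
      (Eventually.of_forall fun j => hq k (φ j)))
  set W : ℕ → ℝ :=
    fun k => (y k - yo) ⬝ᵥ (y k - yo) + ρ ^ 2 * ((s k - so) ⬝ᵥ (s k - so)) with hW
  have hWanti : Antitone W := antitone_nat_of_succ_le fun k => by
    have h₁ := hnn (y (k + 1) - y k)
    have h₂ := mul_nonneg hρ2.le (hnn (s (k + 1) - s k))
    have h₃ := hdesc' k
    simp only [hW]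
    linarith
  have hWlim : Tendsto W atTop (𝓝 0) := by
    have hsub : Tendsto (fun k => W (φ k + 1)) atTop (𝓝 0) := by
      simpa only [sub_self, dotProduct_zero, mul_zero, add_zero] using
        ((hyφ.sub_const yo).dotProduct (hyφ.sub_const yo)).add
        (((hsφ.sub_const so).dotProduct (hsφ.sub_const so)).const_mul (ρ ^ 2))
    exact (tendsto_iff_tendsto_subseq_of_antitone hWanti
      ((tendsto_add_atTop_nat 1).comp hφ.tendsto_atTop)).2 hsub
  have hyo : Tendsto y atTop (𝓝 yo) :=
    tendsto_of_dotProduct_sub_self (squeeze_zero (fun k => hnn _)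
      (fun k => le_add_of_nonneg_right (mul_nonneg hρ2.le (hnn _))) hWlim)
  have hso : Tendsto s atTop (𝓝 so) := by
    refine tendsto_of_dotProduct_sub_self (squeeze_zero (fun k => hnn _) (fun k => ?_)
      (by simpa using hWlim.div_const (ρ ^ 2)))
    rw [le_div_iff₀ hρ2, mul_comm]
    exact le_add_of_nonneg_left (hnn _)
  refine ⟨yo, so, hyo, hso, ?_⟩
  simp only [hq_eq]
  simpa using ((hdy.const_smul ρ⁻¹).add_const c).sub (hso.comp (tendsto_add_atTop_nat 1))

end MonotoneInclusion

/-- ADMM dual-variable convergence: under the saddle-point assumption on the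
unaugmented Lagrangian, the dual iterates `y^k` converge to a point `y°` such
that `(x*, z*, y°)` is again a saddle point of `L₀` (i.e., `y°` is dual
optimal); in particular the sequence `(y^k)` converges. -/
theorem admm_dual_convergence
    {n m p : ℕ}
    (f : (Fin n → ℝ) → ℝ) (g : (Fin m → ℝ) → ℝ)
    (hf : ConvexOn ℝ Set.univ f) (hfc : Continuous f)
    (hg : ConvexOn ℝ Set.univ g) (hgc : Continuous g)
    (A : Matrix (Fin p) (Fin n) ℝ) (B : Matrix (Fin p) (Fin m) ℝ)
    (c : Fin p → ℝ) (ρ : ℝ) (hρ : 0 < ρ)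
    (L0 : (Fin n → ℝ) → (Fin m → ℝ) → (Fin p → ℝ) → ℝ)
    (hL0 : ∀ x z y, L0 x z y =
      f x + g z + y ⬝ᵥ (A.mulVec x + B.mulVec z - c))
    (Lρ : (Fin n → ℝ) → (Fin m → ℝ) → (Fin p → ℝ) → ℝ)
    (hLρ : ∀ x z y, Lρ x z y =
      f x + g z + y ⬝ᵥ (A.mulVec x + B.mulVec z - c) +
        (ρ / 2) * ((A.mulVec x + B.mulVec z - c) ⬝ᵥ (A.mulVec x + B.mulVec z - c)))
    -- saddle point of the unaugmented Lagrangian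
    (xs : Fin n → ℝ) (zs : Fin m → ℝ) (ys : Fin p → ℝ)
    (hsaddle : ∀ x z y, L0 xs zs y ≤ L0 xs zs ys ∧ L0 xs zs ys ≤ L0 x z ys)
    -- ADMM iterations
    (X : ℕ → Fin n → ℝ) (Z : ℕ → Fin m → ℝ) (Y : ℕ → Fin p → ℝ)
    (hX : ∀ k, ∀ u : Fin n → ℝ, Lρ (X (k + 1)) (Z k) (Y k) ≤ Lρ u (Z k) (Y k))
    (hZ : ∀ k, ∀ v : Fin m → ℝ,
      Lρ (X (k + 1)) (Z (k + 1)) (Y k) ≤ Lρ (X (k + 1)) v (Y k))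
    (hY : ∀ k, Y (k + 1) =
      Y k + ρ • (A.mulVec (X (k + 1)) + B.mulVec (Z (k + 1)) - c)) :
    ∃ yo : Fin p → ℝ, Tendsto Y atTop (nhds yo) ∧
      ∀ x z y, L0 xs zs y ≤ L0 xs zs yo ∧ L0 xs zs yo ≤ L0 x z yo := by
  obtain rfl : L0 = fun x z y => f x + g z + y ⬝ᵥ (A *ᵥ x + B *ᵥ z - c) := by
    funext x z y
    exact hL0 x z y
  obtain rfl : Lρ = fun x z y => f x + g z + y ⬝ᵥ (A *ᵥ x + B *ᵥ z - c) +
      (ρ / 2) * ((A *ᵥ x + B *ᵥ z - c) ⬝ᵥ (A *ᵥ x + B *ᵥ z - c)) := by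
    funext x z y
    exact hLρ x z y
  clear hL0 hLρ
  simp only at hsaddle hX hZ ⊢
  have hfeas : A *ᵥ xs + B *ᵥ zs = c := by
    have h := (hsaddle xs zs (ys + (A *ᵥ xs + B *ᵥ zs - c))).1
    rw [add_dotProduct] at h
    have h0 : (A *ᵥ xs + B *ᵥ zs - c) ⬝ᵥ (A *ᵥ xs + B *ᵥ zs - c) = 0 :=
      le_antisymm (by linarith) (dotProduct_self_nonneg_real _)
    exact sub_eq_zero.1 (dotProduct_self_eq_zero.1 h0)
  have hfs : ∀ u, f xs + ys ⬝ᵥ (A *ᵥ xs) ≤ f u + ys ⬝ᵥ (A *ᵥ u) := fun u => by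
    have h := (hsaddle u zs ys).2
    simp only [dotProduct_sub, dotProduct_add] at h
    linarith
  have hgs : ∀ v, g zs + ys ⬝ᵥ (B *ᵥ zs) ≤ g v + ys ⬝ᵥ (B *ᵥ v) := fun v => by
    have h := (hsaddle xs v ys).2
    simp only [dotProduct_sub, dotProduct_add] at h
    linarith
  have hfX : ∀ k u, f (X (k + 1)) +
        (Y (k + 1) - ρ • (B *ᵥ Z (k + 1) - B *ᵥ Z k)) ⬝ᵥ (A *ᵥ X (k + 1)) ≤
      f u + (Y (k + 1) - ρ • (B *ᵥ Z (k + 1) - B *ᵥ Z k)) ⬝ᵥ (A *ᵥ u) := fun k u => by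
    have h := hf.add_dotProduct_le_of_isMin A (Y k) (B *ᵥ Z k - c) ρ (x := X (k + 1))
      (fun u => by
        have h := hX k u
        simp only [add_sub_assoc] at h
        linarith) u
    have hw : Y k + ρ • (A *ᵥ X (k + 1) + (B *ᵥ Z k - c)) =
        Y (k + 1) - ρ • (B *ᵥ Z (k + 1) - B *ᵥ Z k) := by
      rw [hY k]
      module
    rwa [hw] at h
  have hgZ : ∀ k v, g (Z (k + 1)) + Y (k + 1) ⬝ᵥ (B *ᵥ Z (k + 1)) ≤
      g v + Y (k + 1) ⬝ᵥ (B *ᵥ v) := fun k v => by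
    have h := hg.add_dotProduct_le_of_isMin B (Y k) (A *ᵥ X (k + 1) - c) ρ (x := Z (k + 1))
      (fun v => by
        have h := hZ k v
        simp only [add_sub_right_comm, add_comm (_ - c)] at h
        linarith) v
    have hw : Y k + ρ • (B *ᵥ Z (k + 1) + (A *ᵥ X (k + 1) - c)) = Y (k + 1) := by
      rw [hY k]
      module
    rwa [hw] at h
  obtain ⟨yo, so, hyo, hso, hqo⟩ := admm_tendsto_of_monotone (y := fun k => Y (k + 1))
    (s := fun k => B *ᵥ Z (k + 1)) (q := fun k => A *ᵥ X (k + 1)) hρ (fun k => hY (k + 1))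
    (fun j k => dotProduct_sub_nonpos_of_le (hgZ j (Z (k + 1))) (hgZ k (Z (j + 1))))
    (fun j k => dotProduct_sub_nonpos_of_le (hfX (j + 1) (X (k + 1 + 1)))
      (hfX (k + 1) (X (j + 1 + 1)))) hfeas
    (fun k => dotProduct_sub_nonpos_of_le (hgZ k zs) (hgs (Z (k + 1))))
    (fun k => dotProduct_sub_nonpos_of_le (hfX (k + 1) xs) (hfs (X (k + 1 + 1))))
  refine ⟨yo, (tendsto_add_atTop_iff_nat 1).1 hyo, fun x z y => ⟨by simp [hfeas], ?_⟩⟩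
  have hy' : Tendsto (fun k => Y (k + 1 + 1)) atTop (𝓝 yo) := hyo.comp (tendsto_add_atTop_nat 1)
  have hs' : Tendsto (fun k => B *ᵥ Z (k + 1 + 1)) atTop (𝓝 so) :=
    hso.comp (tendsto_add_atTop_nat 1)
  have hw' : Tendsto (fun k => Y (k + 1 + 1) - ρ • (B *ᵥ Z (k + 1 + 1) - B *ᵥ Z (k + 1)))
      atTop (𝓝 yo) := by
    simpa using hy'.sub ((hs'.sub hso).const_smul ρ)
  have hr' : Tendsto (fun k => A *ᵥ X (k + 1 + 1) + B *ᵥ Z (k + 1 + 1) - c) atTop (𝓝 0) := by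
    simpa using (hqo.add hs').sub_const c
  have hle := le_of_tendsto_of_tendsto'
    ((((hr'.dotProduct (tendsto_const_nhds (x := ys))).const_sub (f xs + g zs)).add
      (hw'.dotProduct hqo)).add (hy'.dotProduct hs'))
    (((hw'.dotProduct (tendsto_const_nhds (x := A *ᵥ x))).const_add (f x + g z)).add
      (hy'.dotProduct (tendsto_const_nhds (x := B *ᵥ z))))
    (fun k => by
      have h₁ := hfX (k + 1) x
      have h₂ := hgZ (k + 1) z
      have h₃ := (hsaddle (X (k + 1 + 1)) (Z (k + 1 + 1)) ys).2
      rw [hfeas, sub_self, dotProduct_zero] at h₃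
      rw [dotProduct_comm _ ys]
      linarith)
  simp only [hfeas, sub_self, dotProduct_zero, zero_dotProduct, dotProduct_sub, dotProduct_add]
    at hle ⊢
  linarith
end
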